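/- Fix η > 0 and γ > 1, and let (P_n)_{n≥1} be a sequence of orthogonal projection matrices P_n ∈ ℝ^{n×n} (P_n = P_nᵀ = P_n²) with rank(P_n) = n − ⌈n/γ⌉. Then limsup_{n→∞} p^S(ηP_n) ≤ inf_{s > η/2} { s − (1 + log 2)/2 − ((1 − γ^{−1})/2) log(s − η/2) − (γ^{−1}/2) log s }. -/

import Mathlib

open MeasureTheory Matrix Real Filter

/-- The quadratic form `xᵀ J x`. -/
noncomputable def qf {n : ℕ} (J : Matrix (Fin n) (Fin n) ℝ) (x : Fin n → ℝ) : ℝ :=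
  ∑ i, ∑ j, x i * J i j * x j

/-- The `±1` vector associated to a boolean vector; these enumerate `{-1,1}ⁿ`. -/
noncomputable def sgn {n : ℕ} (b : Fin n → Bool) : Fin n → ℝ :=
  fun i => if b i then 1 else -1

/-- Normalized Ising partition function `Ẑ(J) = 2⁻ⁿ ∑_{x ∈ {-1,1}ⁿ} exp(½ xᵀJx)`. -/
noncomputable def isingZ {n : ℕ} (J : Matrix (Fin n) (Fin n) ℝ) : ℝ :=
  ((2 : ℝ) ^ n)⁻¹ * ∑ b : Fin n → Bool, Real.exp ((1 / 2) * qf J (sgn b))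

/-- Ising pressure `p(J) = n⁻¹ log Ẑ(J)`. -/
noncomputable def isingP {n : ℕ} (J : Matrix (Fin n) (Fin n) ℝ) : ℝ :=
  (n : ℝ)⁻¹ * Real.log (isingZ J)

/-- The uniform (rotation-invariant) probability measure on the sphere of radius `√n`
in Euclidean `ℝⁿ`: the rotation-invariant surface measure on the unit sphere,
normalized to a probability measure and pushed forward by scaling by `√n`. -/
noncomputable def unifSphere (n : ℕ) : Measure (EuclideanSpace ℝ (Fin n)) :=
  Measure.map (fun x : Metric.sphere (0 : EuclideanSpace ℝ (Fin n)) 1 =>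
      (Real.sqrt n) • (x : EuclideanSpace ℝ (Fin n)))
    (((volume : Measure (EuclideanSpace ℝ (Fin n))).toSphere Set.univ)⁻¹ •
      (volume : Measure (EuclideanSpace ℝ (Fin n))).toSphere)

/-- Spherical normalized partition function `Ẑ^S(J) = E_{x ~ Unif(S^{n-1}(√n))} exp(½ xᵀJx)`. -/
noncomputable def sphZ {n : ℕ} (J : Matrix (Fin n) (Fin n) ℝ) : ℝ :=
  ∫ x, Real.exp ((1 / 2) * qf J (fun i => x i)) ∂(unifSphere n)

/-- Spherical pressure `p^S(J) = n⁻¹ log Ẑ^S(J)`. -/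
noncomputable def sphP {n : ℕ} (J : Matrix (Fin n) (Fin n) ℝ) : ℝ :=
  (n : ℝ)⁻¹ * Real.log (sphZ J)

theorem log_Gamma_add_one_le {x : ℝ} (hx : 0 ≤ x) :
    log (Gamma (x + 1)) ≤ (x + 1) * log (x + 1) - x := by
  have hx1 : 0 < x + 1 := by linarith
  have hint : IntegrableOn (fun t : ℝ => exp (-(1 / (x + 1)) * t)) (Set.Ioi 0) :=
    exp_neg_integrableOn_Ioi 0 (by positivity)
  have hval : ∫ t in Set.Ioi (0 : ℝ), exp (-(1 / (x + 1)) * t) = x + 1 := by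
    rw [integral_exp_mul_Ioi (by simpa using hx1)]
    simp
  have hle : Gamma (x + 1) ≤ exp (x * log (x + 1) - x) * (x + 1) := by
    rw [Gamma_eq_integral hx1, ← hval, ← integral_const_mul, hval]
    refine setIntegral_mono_on (GammaIntegral_convergent hx1) (hint.const_mul _)
      measurableSet_Ioi fun t (ht : 0 < t) => ?_
    rw [add_sub_cancel_right, rpow_def_of_pos ht, ← exp_add, ← exp_add]
    refine exp_le_exp.2 ?_
    have h1 : log t ≤ log (x + 1) + (t / (x + 1) - 1) := by
      have := log_le_sub_one_of_pos (div_pos ht hx1)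
      rw [log_div ht.ne' hx1.ne'] at this
      linarith
    have h2 := mul_le_mul_of_nonneg_left h1 hx
    have h3 : x * (t / (x + 1)) = t - 1 / (x + 1) * t := by field_simp; ring
    nlinarith
  have := log_le_log (Gamma_pos_of_pos hx1) hle
  rw [log_mul (exp_ne_zero _) hx1.ne', log_exp] at this
  linarith

theorem qf_eq_inner {n : ℕ} (A : Matrix (Fin n) (Fin n) ℝ) (x : EuclideanSpace ℝ (Fin n)) :
    qf A x = inner ℝ x (A.toEuclideanLin x) := by
  simp only [qf, PiLp.inner_apply, toLpLin_apply, mulVec, dotProduct, Finset.mul_sum,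
    Real.inner_apply, mul_assoc]

theorem qf_eq_sum_eigenvalues {n : ℕ} {A : Matrix (Fin n) (Fin n) ℝ} (hA : A.IsHermitian)
    (x : EuclideanSpace ℝ (Fin n)) :
    qf A x = ∑ i, hA.eigenvalues i * (hA.eigenvectorBasis.repr x i) ^ 2 := by
  have hb (i) : A.toEuclideanLin (hA.eigenvectorBasis i) =
      hA.eigenvalues i • hA.eigenvectorBasis i := by
    ext j
    simpa using congrFun (hA.mulVec_eigenvectorBasis i) j
  rw [qf_eq_inner, ← hA.eigenvectorBasis.sum_inner_mul_inner]
  refine Finset.sum_congr rfl fun i _ => ?_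
  rw [← (isSymmetric_toEuclideanLin_iff.mpr hA) _ x, hb, inner_smul_left,
    hA.eigenvectorBasis.repr_apply_apply, real_inner_comm]
  simp
  ring

theorem integrable_and_integral_exp_neg_sum_mul_sq {n : ℕ}
    (b : OrthonormalBasis (Fin n) ℝ (EuclideanSpace ℝ (Fin n))) {c : Fin n → ℝ}
    (hc : ∀ i, 0 < c i) :
    Integrable (fun x : EuclideanSpace ℝ (Fin n) => exp (-∑ i, c i * (b.repr x i) ^ 2)) ∧
      ∫ x : EuclideanSpace ℝ (Fin n), exp (-∑ i, c i * (b.repr x i) ^ 2) =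
        ∏ i, √(π / c i) := by
  have hmp : MeasurePreserving (fun y : Fin n → ℝ => b.repr.symm (WithLp.toLp 2 y)) :=
    b.measurePreserving_repr_symm.comp (PiLp.volume_preserving_toLp (Fin n))
  have hemb : MeasurableEmbedding (fun y : Fin n → ℝ => b.repr.symm (WithLp.toLp 2 y)) :=
    (b.repr.symm.toHomeomorph.measurableEmbedding).comp
      (MeasurableEquiv.toLp 2 (Fin n → ℝ)).measurableEmbedding
  have hprod (y : Fin n → ℝ) :
      exp (-∑ i, c i * (b.repr (b.repr.symm (WithLp.toLp 2 y)) i) ^ 2) =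
        ∏ i, exp (-(c i) * y i ^ 2) := by
    simp [← exp_sum, Finset.sum_neg_distrib]
  constructor
  · rw [← hmp.integrable_comp_emb hemb]
    simp only [Function.comp_def, hprod]
    exact Integrable.fintype_prod fun i => integrable_exp_neg_mul_sq (hc i)
  · rw [← hmp.integral_comp hemb]
    simp only [hprod]
    rw [integral_fintype_prod_volume_eq_prod (fun i t => exp (-(c i) * t ^ 2))]
    simp only [integral_gaussian]

theorem eigenvalues_eq_zero_or_one {n : ℕ} {A : Matrix (Fin n) (Fin n) ℝ} (hA : A.IsHermitian)
    (hAA : A * A = A) (i : Fin n) : hA.eigenvalues i = 0 ∨ hA.eigenvalues i = 1 := by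
  have h := hA.mulVec_eigenvectorBasis i
  have h2 : A *ᵥ (A *ᵥ ⇑(hA.eigenvectorBasis i)) = A *ᵥ ⇑(hA.eigenvectorBasis i) := by
    rw [mulVec_mulVec, hAA]
  rw [h, mulVec_smul, h, smul_smul] at h2
  have h3 := sub_eq_zero.2 h2
  rw [← sub_smul, smul_eq_zero] at h3
  rcases h3 with h3 | h3
  · have : hA.eigenvalues i * (hA.eigenvalues i - 1) = 0 := by linarith
    rcases mul_eq_zero.1 this with h | h
    · exact .inl h
    · exact .inr (by linarith)
  · exact absurd ((WithLp.ofLp_eq_zero 2).1 h3) (hA.eigenvectorBasis.orthonormal.ne_zero i)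

theorem sum_comp_eigenvalues {n : ℕ} {A : Matrix (Fin n) (Fin n) ℝ} (hA : A.IsHermitian)
    (hAA : A * A = A) (f : ℝ → ℝ) :
    ∑ i, f (hA.eigenvalues i) = A.rank * f 1 + (n - A.rank) * f 0 := by
  have h (i) : f (hA.eigenvalues i) =
      f 0 + (if hA.eigenvalues i ≠ 0 then f 1 - f 0 else 0) := by
    rcases eigenvalues_eq_zero_or_one hA hAA i with h | h <;> simp [h]
  simp_rw [h]
  rw [Finset.sum_add_distrib, ← Finset.sum_filter, hA.rank_eq_card_non_zero_eigs,
    Fintype.card_subtype]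
  simp
  ring

theorem continuous_qf {n : ℕ} (J : Matrix (Fin n) (Fin n) ℝ) :
    Continuous fun x : EuclideanSpace ℝ (Fin n) => qf J x := by
  unfold qf
  fun_prop

theorem qf_smul {n : ℕ} (J : Matrix (Fin n) (Fin n) ℝ) (r : ℝ) (x : EuclideanSpace ℝ (Fin n)) :
    qf J (r • x : EuclideanSpace ℝ (Fin n)) = r ^ 2 * qf J x := by
  simp only [qf, Finset.mul_sum, PiLp.smul_apply, smul_eq_mul]
  refine Finset.sum_congr rfl fun i _ => Finset.sum_congr rfl fun j _ => by ring

theorem volumeIoiPow_annulus {n : ℕ} (hn : 1 ≤ n) :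
    √n ^ n / n ≤ (Measure.volumeIoiPow (n - 1)).real
      {r : Set.Ioi (0 : ℝ) | √n ≤ r ∧ (r : ℝ) < √n * (1 + 1 / n)} := by
  have hn0 : (0 : ℝ) < n := by exact_mod_cast hn
  have hs : 0 < √(n : ℝ) := Real.sqrt_pos.2 hn0
  have hIio (x : Set.Ioi (0 : ℝ)) :
      (Measure.volumeIoiPow (n - 1)).real (Set.Iio x) = x.1 ^ n / n := by
    have hx : 0 ≤ x.1 := le_of_lt x.2
    rw [Measure.real, Measure.volumeIoiPow_apply_Iio, Nat.sub_add_cancel hn, Nat.cast_sub hn]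
    rw [ENNReal.toReal_ofReal] <;> simp; positivity
  have hset : {r : Set.Ioi (0 : ℝ) | √n ≤ r ∧ (r : ℝ) < √n * (1 + 1 / n)} =
      Set.Iio ⟨√n * (1 + 1 / n), Set.mem_Ioi.2 (by positivity)⟩ \ Set.Iio ⟨√n, hs⟩ := by
    ext r
    simp [← Subtype.coe_lt_coe, ← Subtype.coe_le_coe]
  rw [hset, measureReal_sdiff ?_ measurableSet_Iio
    (by simp only [Measure.volumeIoiPow_apply_Iio, ne_eq, ENNReal.ofReal_ne_top, not_false_eq_true]),
    hIio, hIio]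
  · have := one_add_mul_le_pow (a := 1 / (n : ℝ)) (by have : 0 < 1 / (n : ℝ) := by positivity
                                                      linarith) n
    rw [mul_one_div_cancel hn0.ne'] at this
    rw [← sub_div]
    gcongr
    simp only [mul_pow]
    nlinarith [pow_pos hs n]
  · refine Set.Iio_subset_Iio (Subtype.mk_le_mk.2 ?_)
    have : 0 < √(n : ℝ) * (1 / n) := by positivity
    linarith

theorem integrable_and_integral_eq_polar {n : ℕ} [Nontrivial (EuclideanSpace ℝ (Fin n))]
    (g : EuclideanSpace ℝ (Fin n) → ℝ) :
    (Integrable g → Integrable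
      (fun z : Metric.sphere (0 : EuclideanSpace ℝ (Fin n)) 1 × Set.Ioi (0 : ℝ) =>
        g ((z.2 : ℝ) • (z.1 : EuclideanSpace ℝ (Fin n))))
      ((volume : Measure (EuclideanSpace ℝ (Fin n))).toSphere.prod
        (Measure.volumeIoiPow (n - 1)))) ∧
    ∫ x, g x = ∫ z, g ((z.2 : ℝ) • (z.1 : EuclideanSpace ℝ (Fin n)))
      ∂((volume : Measure (EuclideanSpace ℝ (Fin n))).toSphere.prod
        (Measure.volumeIoiPow (n - 1))) := by
  have hmp := (volume : Measure (EuclideanSpace ℝ (Fin n))).measurePreserving_homeomorphUnitSphereProd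
  rw [finrank_euclideanSpace_fin] at hmp
  have hemb := (homeomorphUnitSphereProd (EuclideanSpace ℝ (Fin n))).measurableEmbedding
  have hg (x : ({0}ᶜ : Set (EuclideanSpace ℝ (Fin n)))) :
      g (((homeomorphUnitSphereProd _ x).2 : ℝ) •
        ((homeomorphUnitSphereProd _ x).1 : EuclideanSpace ℝ (Fin n))) = g x := by
    have hx : ‖(x : EuclideanSpace ℝ (Fin n))‖ ≠ 0 := norm_ne_zero_iff.2 x.2
    simp [smul_smul, hx]
  constructor
  · intro h
    rw [← hmp.integrable_comp_emb hemb]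
    simp only [Function.comp_def, hg]
    exact (integrableOn_iff_comap_subtypeVal (measurableSet_singleton _).compl).1 h.integrableOn
  · rw [← hmp.integral_comp hemb]
    simp only [hg]
    rw [integral_subtype_comap (measurableSet_singleton _).compl g, restrict_compl_singleton]

theorem toSphere_real_univ_pos {n : ℕ} (hn : 1 ≤ n) :
    0 < (volume : Measure (EuclideanSpace ℝ (Fin n))).toSphere.real Set.univ := by
  have hn0 : (0 : ℝ) < n := by exact_mod_cast hn
  rw [Measure.toSphere_real_apply_univ, finrank_euclideanSpace_fin]
  exact mul_pos hn0 (ENNReal.toReal_pos (Metric.measure_ball_pos _ _ one_pos).ne'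
    measure_ball_lt_top.ne)

theorem sphZ_mul_toSphere {n : ℕ} (hn : 1 ≤ n) (J : Matrix (Fin n) (Fin n) ℝ) :
    sphZ J * (volume : Measure (EuclideanSpace ℝ (Fin n))).toSphere.real Set.univ =
      ∫ u : Metric.sphere (0 : EuclideanSpace ℝ (Fin n)) 1,
        exp ((1 / 2) * qf J (√n • (u : EuclideanSpace ℝ (Fin n)) : EuclideanSpace ℝ (Fin n)))
        ∂(volume : Measure (EuclideanSpace ℝ (Fin n))).toSphere := by
  have hpos := (toSphere_real_univ_pos hn).ne'
  rw [sphZ, unifSphere, integral_map (by fun_prop)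
    (((continuous_qf J).const_mul _).rexp.aestronglyMeasurable), integral_smul_measure,
    ENNReal.toReal_inv, ← Measure.real, smul_eq_mul, mul_comm, mul_inv_cancel_left₀ hpos]

theorem integrable_exp_qf_sphere {n : ℕ} (J : Matrix (Fin n) (Fin n) ℝ) (r : ℝ) :
    Integrable (fun u : Metric.sphere (0 : EuclideanSpace ℝ (Fin n)) 1 =>
        exp ((1 / 2) * qf J (r • (u : EuclideanSpace ℝ (Fin n)) : EuclideanSpace ℝ (Fin n))))
      (volume : Measure (EuclideanSpace ℝ (Fin n))).toSphere := by
  have hc : Continuous (fun u : Metric.sphere (0 : EuclideanSpace ℝ (Fin n)) 1 =>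
      exp ((1 / 2) * qf J (r • (u : EuclideanSpace ℝ (Fin n)) : EuclideanSpace ℝ (Fin n)))) :=
    (((continuous_qf J).comp (continuous_subtype_val.const_smul r)).const_mul _).rexp
  exact hc.integrable_of_hasCompactSupport (HasCompactSupport.of_compactSpace _)

theorem one_le_sphZ {n : ℕ} (hn : 1 ≤ n) {J : Matrix (Fin n) (Fin n) ℝ}
    (hJ : ∀ x : EuclideanSpace ℝ (Fin n), 0 ≤ qf J x) : 1 ≤ sphZ J := by
  refine le_of_mul_le_mul_right ?_ (toSphere_real_univ_pos hn)
  rw [sphZ_mul_toSphere hn]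
  calc _ = ∫ u : Metric.sphere (0 : EuclideanSpace ℝ (Fin n)) 1, (1 : ℝ)
        ∂(volume : Measure (EuclideanSpace ℝ (Fin n))).toSphere := by simp
    _ ≤ _ := integral_mono (integrable_const _) (integrable_exp_qf_sphere J _) fun u =>
        one_le_exp (mul_nonneg (by norm_num) (hJ _))

theorem sphZ_mul_le_integral {n : ℕ} (hn : 1 ≤ n) {J : Matrix (Fin n) (Fin n) ℝ}
    (hJ : ∀ x : EuclideanSpace ℝ (Fin n), 0 ≤ qf J x) {s : ℝ} (hs : 0 < s)
    (hint : Integrable fun x : EuclideanSpace ℝ (Fin n) =>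
      exp (-s * ‖x‖ ^ 2 + (1 / 2) * qf J x)) :
    sphZ J * (volume : Measure (EuclideanSpace ℝ (Fin n))).real (Metric.ball 0 1) *
        (√n ^ n * exp (-s * (n + 3))) ≤
      ∫ x : EuclideanSpace ℝ (Fin n), exp (-s * ‖x‖ ^ 2 + (1 / 2) * qf J x) := by
  have : Nonempty (Fin n) := ⟨⟨0, hn⟩⟩
  have hn0 : (0 : ℝ) < n := by exact_mod_cast hn
  have hn1 : (1 : ℝ) ≤ n := by exact_mod_cast hn
  have hsq : √(n : ℝ) ^ 2 = n := Real.sq_sqrt hn0.le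
  obtain ⟨hI, hE⟩ := integrable_and_integral_eq_polar
    (fun x : EuclideanSpace ℝ (Fin n) => exp (-s * ‖x‖ ^ 2 + (1 / 2) * qf J x))
  set A : Set (Set.Ioi (0 : ℝ)) := {r | √n ≤ r ∧ (r : ℝ) < √n * (1 + 1 / n)} with hA
  have hAm : MeasurableSet A :=
    (measurableSet_le measurable_const measurable_subtype_coe).inter
      (measurableSet_lt measurable_subtype_coe measurable_const)
  set F : Metric.sphere (0 : EuclideanSpace ℝ (Fin n)) 1 → ℝ := fun u =>
    exp ((1 / 2) * qf J (√n • (u : EuclideanSpace ℝ (Fin n)) : EuclideanSpace ℝ (Fin n))) with hF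
  have key : ∫ z, F z.1 * A.indicator (fun _ => exp (-s * (n + 3))) z.2
        ∂((volume : Measure (EuclideanSpace ℝ (Fin n))).toSphere.prod
          (Measure.volumeIoiPow (n - 1))) ≤
      ∫ x : EuclideanSpace ℝ (Fin n), exp (-s * ‖x‖ ^ 2 + (1 / 2) * qf J x) := by
    rw [hE]
    refine integral_mono_of_nonneg (ae_of_all _ fun z => ?_) (hI hint) (ae_of_all _ fun z => ?_)
    · exact mul_nonneg (exp_nonneg _) (Set.indicator_nonneg (fun _ _ => exp_nonneg _) _)
    · obtain ⟨u, r, hr⟩ := z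
      replace hr : 0 < r := hr
      by_cases hrA : (⟨r, hr⟩ : Set.Ioi (0 : ℝ)) ∈ A
      · obtain ⟨h1, h2⟩ := hrA
        replace h1 : √n ≤ r := h1
        replace h2 : r < √n * (1 + 1 / n) := h2
        have hrA : (⟨r, hr⟩ : Set.Ioi (0 : ℝ)) ∈ A := ⟨h1, h2⟩
        have hu : ‖(u : EuclideanSpace ℝ (Fin n))‖ = 1 := by simp
        simp only [hF, Set.indicator_of_mem hrA, norm_smul, hu, mul_one, norm_eq_abs, sq_abs,
          qf_smul, hsq, ← exp_add]
        have hlow : (n : ℝ) ≤ r ^ 2 := hsq ▸ pow_le_pow_left₀ (Real.sqrt_nonneg _) h1 2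
        have hup : r ^ 2 ≤ n + 3 := by
          calc (r ^ 2 : ℝ) ≤ (√(n : ℝ) * (1 + 1 / (n : ℝ))) ^ 2 := by gcongr
            _ = (n : ℝ) + 2 + 1 / n := by rw [mul_pow, hsq]; field_simp; ring
            _ ≤ n + 3 := by
              have : 1 / (n : ℝ) ≤ 1 := by rw [div_le_one hn0]; exact hn1
              linarith
        refine exp_le_exp.2 ?_
        have := mul_le_mul_of_nonneg_right hlow (hJ u)
        have := mul_le_mul_of_nonneg_left hup hs.le
        linarith
      · simp only [Set.indicator_of_notMem hrA, mul_zero]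
        exact exp_nonneg _
  rw [integral_prod_mul, ← sphZ_mul_toSphere hn, integral_indicator_const _ hAm,
    Measure.toSphere_real_apply_univ, finrank_euclideanSpace_fin, smul_eq_mul] at key
  refine le_trans ?_ key
  have hvol := volumeIoiPow_annulus hn
  have hZ : 0 ≤ sphZ J := zero_le_one.trans (one_le_sphZ hn hJ)
  calc _ = sphZ J * (n * (volume : Measure (EuclideanSpace ℝ (Fin n))).real (Metric.ball 0 1)) *
        (√n ^ n / n * exp (-s * (n + 3))) := by field_simp
    _ ≤ _ := by gcongr

theorem log_sphZ_smul_projection_le {n : ℕ} (hn : 1 ≤ n) {P : Matrix (Fin n) (Fin n) ℝ}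
    (hP : P.IsHermitian) (hPP : P * P = P) {η s : ℝ} (hη : 0 ≤ η) (hs : η / 2 < s) :
    0 ≤ log (sphZ (η • P)) ∧
    log (sphZ (η • P)) ≤ s * (n + 3) - n / 2 * log n + log (Gamma (n / 2 + 1)) -
      P.rank / 2 * log (s - η / 2) - (n - P.rank) / 2 * log s := by
  have : Nonempty (Fin n) := ⟨⟨0, hn⟩⟩
  have hn0 : (0 : ℝ) < n := by exact_mod_cast hn
  have hs0 : 0 < s := by linarith
  have hqf (x : EuclideanSpace ℝ (Fin n)) :
      qf (η • P) x = ∑ i, η * hP.eigenvalues i * (hP.eigenvectorBasis.repr x i) ^ 2 := by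
    have : qf (η • P) x = η * qf P x := by
      simp only [qf, Finset.mul_sum, Matrix.smul_apply, smul_eq_mul]
      exact Finset.sum_congr rfl fun i _ => Finset.sum_congr rfl fun j _ => by ring
    rw [this, qf_eq_sum_eigenvalues hP, Finset.mul_sum]
    simp only [mul_assoc]
  have hJ (x : EuclideanSpace ℝ (Fin n)) : 0 ≤ qf (η • P) x := by
    rw [hqf]
    refine Finset.sum_nonneg fun i _ => ?_
    rcases eigenvalues_eq_zero_or_one hP hPP i with h | h <;> rw [h] <;> positivity
  have hc (i) : 0 < s - η / 2 * hP.eigenvalues i := by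
    rcases eigenvalues_eq_zero_or_one hP hPP i with h | h <;> rw [h] <;> linarith
  have hexp (x : EuclideanSpace ℝ (Fin n)) :
      -s * ‖x‖ ^ 2 + (1 / 2) * qf (η • P) x =
        -∑ i, (s - η / 2 * hP.eigenvalues i) * (hP.eigenvectorBasis.repr x i) ^ 2 := by
    rw [hqf, ← hP.eigenvectorBasis.repr.norm_map x, EuclideanSpace.norm_sq_eq, Finset.mul_sum,
      Finset.mul_sum, ← Finset.sum_add_distrib, ← Finset.sum_neg_distrib]
    refine Finset.sum_congr rfl fun i _ => ?_
    rw [norm_eq_abs, sq_abs]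
    ring
  obtain ⟨hint, hval⟩ := integrable_and_integral_exp_neg_sum_mul_sq hP.eigenvectorBasis hc
  simp only [← hexp] at hint hval
  have hmain := sphZ_mul_le_integral hn hJ hs0 hint
  have hZ := one_le_sphZ hn hJ
  have hZ0 : 0 < sphZ (η • P) := by linarith
  refine ⟨log_nonneg hZ, ?_⟩
  have hG : 0 < Gamma ((n : ℝ) / 2 + 1) := Gamma_pos_of_pos (by positivity)
  have hball : (volume : Measure (EuclideanSpace ℝ (Fin n))).real (Metric.ball 0 1) =
      √π ^ n / Gamma (n / 2 + 1) := by
    rw [Measure.real, EuclideanSpace.volume_ball]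
    simp only [ENNReal.ofReal_one, one_pow, one_mul, Fintype.card_fin]
    exact ENNReal.toReal_ofReal (by positivity)
  have hsqn : 0 < √(n : ℝ) := Real.sqrt_pos.2 hn0
  have hsqpi : 0 < √π := Real.sqrt_pos.2 pi_pos
  rw [hval, hball] at hmain
  have hlog := log_le_log (by positivity) hmain
  rw [log_mul (by positivity) (by positivity), log_mul hZ0.ne' (by positivity),
    log_mul (by positivity) (exp_ne_zero _), log_div (by positivity) hG.ne', log_pow, log_pow,
    log_sqrt hn0.le, log_sqrt pi_pos.le, log_exp,
    log_prod fun i _ => (Real.sqrt_pos.2 (div_pos pi_pos (hc i))).ne'] at hlog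
  have hsum : ∑ i, log √(π / (s - η / 2 * hP.eigenvalues i)) =
      n / 2 * log π - P.rank / 2 * log (s - η / 2) - (n - P.rank) / 2 * log s := by
    rw [sum_comp_eigenvalues hP hPP fun t => log √(π / (s - η / 2 * t))]
    have h1 : 0 < s - η / 2 := by linarith
    simp only [mul_one, mul_zero, sub_zero]
    rw [log_sqrt (by positivity), log_sqrt (by positivity), log_div pi_ne_zero h1.ne',
      log_div pi_ne_zero hs0.ne']
    ring
  rw [hsum] at hlog
  linarith

theorem sphP_smul_projection_le {n : ℕ} (hn : 1 ≤ n) {P : Matrix (Fin n) (Fin n) ℝ}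
    (hP : P.IsHermitian) (hPP : P * P = P) {η s : ℝ} (hη : 0 ≤ η) (hs : η / 2 < s) {k : ℕ}
    (hk : k ≤ n) (hrank : P.rank = n - k) :
    sphP (η • P) ≤ s + 3 * s * (n : ℝ)⁻¹ + (1 / 2 + (n : ℝ)⁻¹) * log (1 / 2 + (n : ℝ)⁻¹) +
      log n / n - 1 / 2 - (1 - (k : ℝ) / n) / 2 * log (s - η / 2) - (k : ℝ) / n / 2 * log s := by
  have hn0 : (0 : ℝ) < n := by exact_mod_cast hn
  have h1 := (log_sphZ_smul_projection_le hn hP hPP hη hs).2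
  have h2 := log_Gamma_add_one_le (x := (n : ℝ) / 2) (by positivity)
  rw [show (n : ℝ) / 2 + 1 = n * (1 / 2 + (n : ℝ)⁻¹) by field_simp,
    log_mul hn0.ne' (by positivity)] at h2
  rw [show (n : ℝ) / 2 + 1 = n * (1 / 2 + (n : ℝ)⁻¹) by field_simp, hrank, Nat.cast_sub hk] at h1
  rw [sphP]
  generalize log (1 / 2 + (n : ℝ)⁻¹) = L at h2 ⊢
  have h3 := h1.trans (sub_le_sub_right (sub_le_sub_right (add_le_add_right h2 _) _) _)
  refine (mul_le_mul_of_nonneg_left h3 (by positivity)).trans_eq ?_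
  field_simp
  ring

theorem tendsto_pressure_bound {s η γ : ℝ} (hγ : 0 < γ) :
    Tendsto (fun n : ℕ => s + 3 * s * (n : ℝ)⁻¹ +
      (1 / 2 + (n : ℝ)⁻¹) * log (1 / 2 + (n : ℝ)⁻¹) + log n / n - 1 / 2 -
      (1 - (⌈(n : ℝ) / γ⌉₊ : ℝ) / n) / 2 * log (s - η / 2) -
      (⌈(n : ℝ) / γ⌉₊ : ℝ) / n / 2 * log s) atTop
    (nhds (s - (1 + log 2) / 2 - ((1 - γ⁻¹) / 2) * log (s - η / 2) - (γ⁻¹ / 2) * log s)) := by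
  have hinv : Tendsto (fun n : ℕ => (n : ℝ)⁻¹) atTop (nhds 0) := tendsto_inv_atTop_nhds_zero_nat
  have hlog : Tendsto (fun n : ℕ => log n / n) atTop (nhds 0) := by
    have := (isLittleO_log_id_atTop.tendsto_div_nhds_zero).comp (tendsto_natCast_atTop_atTop (R := ℝ))
    exact this
  have hceil : Tendsto (fun n : ℕ => (⌈(n : ℝ) / γ⌉₊ : ℝ) / n) atTop (nhds γ⁻¹) := by
    have := (tendsto_nat_ceil_mul_div_atTop (inv_nonneg.2 hγ.le)).comp
      (tendsto_natCast_atTop_atTop (R := ℝ))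
    simpa [Function.comp_def, div_eq_inv_mul] using this
  have hhalf : Tendsto (fun n : ℕ => 1 / 2 + (n : ℝ)⁻¹) atTop (nhds (1 / 2)) := by
    simpa only [add_zero] using hinv.const_add (1 / 2)
  have hhl := hhalf.mul (hhalf.log (by norm_num))
  have hlim := ((((((hinv.const_mul (3 * s)).const_add s).add hhl).add hlog).sub_const
    (1 / 2)).sub (((hceil.const_sub 1).div_const 2).mul_const (log (s - η / 2)))).sub
    ((hceil.div_const 2).mul_const (log s))
  convert hlim using 2
  rw [one_div, log_inv]
  ring

/-- For orthogonal projections `Pₙ` of rank `n - ⌈n/γ⌉` (`γ > 1`, `η > 0`),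
`limsup_n p^S(ηPₙ) ≤ inf_{s > η/2} { s - (1+log 2)/2 - ((1-γ⁻¹)/2) log(s - η/2) - (γ⁻¹/2) log s }`. -/
theorem stmt_13 (η γ : ℝ) (hη : 0 < η) (hγ : 1 < γ)
    (P : ∀ n : ℕ, Matrix (Fin n) (Fin n) ℝ)
    (hPsymm : ∀ n, (P n)ᵀ = P n) (hPproj : ∀ n, P n * P n = P n)
    (hrank : ∀ n, (P n).rank = n - ⌈(n : ℝ) / γ⌉₊) :
    Filter.limsup (fun n : ℕ => sphP (η • P n)) atTop ≤
      ⨅ s : {s : ℝ // η / 2 < s}, ((s : ℝ) - (1 + Real.log 2) / 2 -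
        ((1 - γ⁻¹) / 2) * Real.log ((s : ℝ) - η / 2) - (γ⁻¹ / 2) * Real.log s) := by
  have : Nonempty {s : ℝ // η / 2 < s} := ⟨⟨η / 2 + 1, by linarith⟩⟩
  refine le_ciInf fun ⟨s, hs⟩ => ?_
  have hherm (n) : (P n).IsHermitian := by
    rw [Matrix.IsHermitian, conjTranspose_eq_transpose_of_trivial, hPsymm n]
  have htends := tendsto_pressure_bound (s := s) (η := η) (zero_lt_one.trans hγ)
  refine (limsup_le_limsup ?_ ?_ htends.isBoundedUnder_le).trans_eq htends.limsup_eq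
  · filter_upwards [eventually_ge_atTop 1] with n hn
    refine sphP_smul_projection_le hn (hherm n) (hPproj n) hη.le hs ?_ (hrank n)
    exact Nat.ceil_le.2 (div_le_self n.cast_nonneg hγ.le)
  · refine isCoboundedUnder_le_of_eventually_le (x := 0) atTop ?_
    filter_upwards [eventually_ge_atTop 1] with n hn
    exact mul_nonneg (by positivity)
      (log_sphZ_smul_projection_le hn (hherm n) (hPproj n) hη.le hs).1
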